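/- Rewriting the algorithm's output: let h : ℝ → ℝ be convex and 1-Lipschitz, and let h′ denote its right derivative (which exists everywhere and agrees almost everywhere with the derivative of h). Then for all μ ∈ ℝ, σ > 0 and c ∈ [0, σ²], E_Z[f_{μ,σ,h}(μ + √(σ² − c)·Z)] = −(1/2)·∫_0^1 τ^{−1/2} · E_Z[h′(μ + √(σ² − τc)·Z)] dτ. -/

import Mathlib

open MeasureTheory ProbabilityTheory Real Finset

/-- Expectation over a standard normal random variable `Z ∼ N(0,1)`. -/
noncomputable def gaussExp (f : ℝ → ℝ) : ℝ := ∫ z, f z ∂(gaussianReal 0 1)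

/-- Probability density function of the normal distribution `N(μ, σ²)`. -/
noncomputable def normalPdf (μ σ x : ℝ) : ℝ :=
  (Real.sqrt (2 * Real.pi * σ ^ 2))⁻¹ * Real.exp (-(x - μ) ^ 2 / (2 * σ ^ 2))

/-- The unique bounded solution `f_{μ,σ,h}` of the Stein equation
`σ² f′(x) − (x−μ) f(x) = h(x) − E_Z[h(μ+σZ)]`. -/
noncomputable def steinSol (μ σ : ℝ) (h : ℝ → ℝ) (x : ℝ) : ℝ :=
  (σ ^ 2 * normalPdf μ σ x)⁻¹ *
    ∫ z in Set.Iic x, (h z - gaussExp (fun w => h (μ + σ * w))) * normalPdf μ σ z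


open Filter Topology

/-- standard Gaussian measure -/
noncomputable abbrev gam : Measure ℝ := gaussianReal 0 1

theorem uniq_laplace (g : ℝ → ℝ) (hg : Continuous g)
    (hint : ∀ s : ℝ, Integrable (fun x => g x * rexp (s * x)))
    (hzero : ∀ s : ℝ, s ≠ 0 → ∫ x, g x * rexp (s * x) = 0) : ∀ x, g x = 0 := by
  have key : ∀ f : ℝ → ℝ, Continuous f → (∀ s : ℝ, Integrable (fun x => f x * rexp (s * x))) →
      (∀ s : ℝ, Integrable (fun x => rexp (s * id x))
        (volume.withDensity (fun x => ((f x).toNNReal : ENNReal)))) ∧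
      (∀ s : ℝ, mgf id (volume.withDensity (fun x => ((f x).toNNReal : ENNReal))) s
        = ∫ x, max (f x) 0 * rexp (s * x)) ∧
      (∀ s : ℝ, Integrable (fun x => max (f x) 0 * rexp (s * x))) := by
    intro f hf hfi
    have hm : Measurable (fun x => (f x).toNNReal) := by fun_prop
    have h3 : ∀ s : ℝ, Integrable (fun x => max (f x) 0 * rexp (s * x)) := by
      intro s
      refine (hfi s).mono (by fun_prop) (ae_of_all _ fun x => ?_)
      rw [norm_mul, norm_mul]
      gcongr
      rw [Real.norm_eq_abs, Real.norm_eq_abs, abs_of_nonneg (le_max_right _ _)]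
      exact max_le (le_abs_self _) (abs_nonneg _)
    refine ⟨fun s => ?_, fun s => ?_, h3⟩
    · rw [integrable_withDensity_iff_integrable_smul hm]
      refine (h3 s).congr (ae_of_all _ fun x => ?_)
      simp [NNReal.smul_def, Real.coe_toNNReal']
    · unfold mgf
      rw [integral_withDensity_eq_integral_smul hm]
      refine integral_congr_ae (ae_of_all _ fun x => ?_)
      simp [NNReal.smul_def, Real.coe_toNNReal']
  have hintn : ∀ s : ℝ, Integrable (fun x => (-g x) * rexp (s * x)) := by
    intro s
    refine (hint s).neg.congr (ae_of_all _ fun x => ?_)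
    simp
  obtain ⟨a1, a2, a3⟩ := key g hg hint
  obtain ⟨b1, b2, b3⟩ := key (fun x => -g x) hg.neg hintn
  set m1 := volume.withDensity (fun x => ((g x).toNNReal : ENNReal)) with hm1
  set m2 := volume.withDensity (fun x => ((-g x).toNNReal : ENNReal)) with hm2
  have i1 : IsFiniteMeasure m1 := by
    have := a1 0
    simp only [zero_mul, Real.exp_zero] at this
    exact (integrable_const_iff_isFiniteMeasure (one_ne_zero)).1 this
  have i2 : IsFiniteMeasure m2 := by
    have := b1 0
    simp only [zero_mul, Real.exp_zero] at this
    exact (integrable_const_iff_isFiniteMeasure (one_ne_zero)).1 this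
  have hne : ∀ s : ℝ, s ≠ 0 → mgf id m1 s = mgf id m2 s := by
    intro s hs
    rw [a2, b2, ← sub_eq_zero, ← integral_sub (a3 s) (b3 s)]
    refine Eq.trans ?_ (hzero s hs)
    refine integral_congr_ae (ae_of_all _ fun x => ?_)
    simp only
    rw [← sub_mul]
    congr 1
    rcases le_total (g x) 0 with h | h
    · rw [max_eq_right h, max_eq_left (by linarith)]; ring
    · rw [max_eq_left h, max_eq_right (by linarith)]; ring
  have hmgf : mgf id m1 = mgf id m2 := by
    have c1 := continuous_mgf a1
    have c2 := continuous_mgf b1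
    refine Continuous.ext_on (dense_compl_singleton (0 : ℝ)) c1 c2 ?_
    intro s hs
    exact hne s hs
  have hmass : m1 = 0 ↔ m2 = 0 := by
    have h0 := congrFun hmgf 0
    rw [mgf_zero', mgf_zero'] at h0
    rw [← Measure.measure_univ_eq_zero, ← Measure.measure_univ_eq_zero,
      ← measureReal_eq_zero_iff, ← measureReal_eq_zero_iff, h0]
  have hc : complexMGF id m1 = complexMGF id m2 := by
    funext z
    refine eqOn_complexMGF_of_mgf' hmgf hmass ?_
    have : integrableExpSet id m1 = Set.univ := by
      ext t; simpa [integrableExpSet] using a1 t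
    simp [this]
  have hm := Measure.ext_of_complexMGF_id_eq hc
  have hlt : ∫⁻ x, ((g x).toNNReal : ENNReal) ≠ ⊤ := by
    have := measure_ne_top m1 Set.univ
    rwa [hm1, withDensity_apply _ MeasurableSet.univ, Measure.restrict_univ] at this
  have hae := (withDensity_eq_iff (by fun_prop) (by fun_prop) hlt).1 hm
  have : g =ᵐ[volume] fun _ => 0 := by
    filter_upwards [hae] with x hx
    have hx' : (g x).toNNReal = (-g x).toNNReal := by exact_mod_cast hx
    have h2 := congrArg NNReal.toReal hx'
    rw [Real.coe_toNNReal', Real.coe_toNNReal'] at h2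
    rcases le_total (g x) 0 with h | h
    · rw [max_eq_right h, max_eq_left (by linarith)] at h2; linarith
    · rw [max_eq_left h, max_eq_right (by linarith)] at h2; linarith
  exact congrFun ((Continuous.ae_eq_iff_eq volume hg continuous_const).1 this)

theorem gam_tilt (g : ℝ → ℝ) (s : ℝ) :
    ∫ x, g x * rexp (s * x) ∂gam = rexp (s ^ 2 / 2) * ∫ x, g (x + s) ∂gam := by
  rw [integral_gaussianReal_eq_integral_smul one_ne_zero,
    integral_gaussianReal_eq_integral_smul one_ne_zero, ← integral_const_mul,
    ← integral_add_right_eq_self _ s]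
  refine integral_congr_ae (ae_of_all _ fun x => ?_)
  simp only [gaussianPDFReal, smul_eq_mul, NNReal.coe_one]
  have : rexp (-(x + s - 0) ^ 2 / (2 * 1)) * rexp (s * (x + s))
      = rexp (s ^ 2 / 2) * rexp (-(x - 0) ^ 2 / (2 * 1)) := by
    rw [← Real.exp_add, ← Real.exp_add]; congr 1; ring
  linear_combination ((√(2 * π * 1))⁻¹ * g (x + s)) * this

theorem gam_map_mul (a : ℝ) : gam.map (fun x => a * x) = gaussianReal 0 (NNReal.mk (a ^ 2) (sq_nonneg a)) := by
  have := gaussianReal_map_const_mul (μ := 0) (v := 1) a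
  simpa using this

theorem gam_mix (p : ℝ → ℝ) (hp : Measurable p) (hb : ∀ x, |p x| ≤ 1) (m a b r : ℝ)
    (hr : r ^ 2 = a ^ 2 + b ^ 2) :
    ∫ y, ∫ z, p (m + a * y + b * z) ∂gam ∂gam = ∫ w, p (m + r * w) ∂gam := by
  have h1 : gam.map (fun x => a * x) ∗ gam.map (fun x => b * x) = gam.map (fun x => r * x) := by
    rw [gam_map_mul, gam_map_mul, gam_map_mul, gaussianReal_conv_gaussianReal]
    congr 1
    · simp
    · ext; simp [hr]
  have hmp : Measurable fun w => p (m + w) := by fun_prop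
  have e1 : ∫ w, p (m + r * w) ∂gam = ∫ w, p (m + w) ∂(gam.map (fun x => r * x)) := by
    rw [integral_map (by fun_prop) hmp.aestronglyMeasurable]
  have : IsProbabilityMeasure (gam.map (fun x => a * x)) :=
    Measure.isProbabilityMeasure_map (by fun_prop)
  have : IsProbabilityMeasure (gam.map (fun x => b * x)) :=
    Measure.isProbabilityMeasure_map (by fun_prop)
  have : IsProbabilityMeasure (gam.map (fun x => r * x)) :=
    Measure.isProbabilityMeasure_map (by fun_prop)
  rw [e1, ← h1, integral_conv]
  · have hsm : StronglyMeasurable (fun x => ∫ y, p (m + (x + y)) ∂(gam.map (fun x => b * x))) := by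
      have : StronglyMeasurable (fun q : ℝ × ℝ => p (m + (q.1 + q.2))) :=
        (by fun_prop : Measurable (fun q : ℝ × ℝ => p (m + (q.1 + q.2)))).stronglyMeasurable
      exact this.integral_prod_right'
    rw [integral_map (by fun_prop) hsm.aestronglyMeasurable]
    congr 1; funext y
    rw [integral_map (by fun_prop)
      (by fun_prop : Measurable fun w => p (m + (a * y + w))).aestronglyMeasurable]
    simp only [add_assoc]
  · rw [h1]
    exact Integrable.of_bound hmp.aestronglyMeasurable 1 (ae_of_all _ fun x => hb _)

theorem intInt_inv_sqrt : IntervalIntegrable (fun τ : ℝ => (√τ)⁻¹) volume 0 1 := by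
  have h := intervalIntegral.intervalIntegrable_rpow' (a := 0) (b := 1) (r := -(1 / 2)) (by norm_num)
  refine h.congr_ae ?_
  refine (ae_restrict_iff' measurableSet_uIoc).2 (ae_of_all _ fun τ hτ => ?_)
  rw [Set.uIoc_of_le zero_le_one] at hτ
  simp only
  rw [Real.rpow_neg hτ.1.le, Real.sqrt_eq_rpow]

/-- Mehler average of `p` -/
noncomputable def mehler (p : ℝ → ℝ) (τ x : ℝ) : ℝ := ∫ z, p (√τ * x + √(1 - τ) * z) ∂gam

/-- the integral representation (up to the factor `-1/2`) -/
noncomputable def steinF (p : ℝ → ℝ) (x : ℝ) : ℝ := ∫ τ in (0 : ℝ)..1, (√τ)⁻¹ * mehler p τ x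

theorem mehler_meas (p : ℝ → ℝ) (hp : Measurable p) :
    StronglyMeasurable (fun q : ℝ × ℝ => mehler p q.1 q.2) := by
  have : StronglyMeasurable (fun q : (ℝ × ℝ) × ℝ => p (√q.1.1 * q.1.2 + √(1 - q.1.1) * q.2)) :=
    (by fun_prop : Measurable
      (fun q : (ℝ × ℝ) × ℝ => p (√q.1.1 * q.1.2 + √(1 - q.1.1) * q.2))).stronglyMeasurable
  exact this.integral_prod_right'

theorem gam_bound (q : ℝ → ℝ) (hb : ∀ x, |q x| ≤ 1) : |∫ z, q z ∂gam| ≤ 1 := by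
  have := norm_integral_le_of_norm_le_const (μ := gam) (C := 1) (f := q) (ae_of_all _ hb)
  simpa using this

theorem mehler_bound (p : ℝ → ℝ) (hb : ∀ x, |p x| ≤ 1) (τ x : ℝ) : |mehler p τ x| ≤ 1 :=
  gam_bound _ fun _ => hb _

theorem mehler_cont (p : ℝ → ℝ) (hp : Monotone p) (hb : ∀ x, |p x| ≤ 1) (τ : ℝ) (hτ : τ < 1) :
    Continuous (mehler p τ) := by
  rw [continuous_iff_continuousAt]
  intro x
  have hm := hp.measurable
  refine continuousAt_of_dominated (bound := fun _ => 1) ?_ ?_ (integrable_const _) ?_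
  · exact Eventually.of_forall fun y =>
      (by fun_prop : Measurable fun z => p (√τ * y + √(1 - τ) * z)).aestronglyMeasurable
  · exact Eventually.of_forall fun y => ae_of_all _ fun z => hb _
  · have hpos : 0 < √(1 - τ) := Real.sqrt_pos.2 (by linarith)
    have hc := hp.countable_not_continuousAt
    have hc' : ((fun z => √τ * x + √(1 - τ) * z) ⁻¹' {y | ¬ ContinuousAt p y}).Countable := by
      refine hc.preimage ?_
      intro a b hab
      simp only [add_right_inj] at hab
      exact mul_left_cancel₀ hpos.ne' hab
    have : NullSingletonClass gam := nullSingletonClass_gaussianReal one_ne_zero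
    filter_upwards [hc'.ae_notMem gam] with z hz
    have hz' : ContinuousAt p (√τ * x + √(1 - τ) * z) := by
      by_contra hcon; exact hz hcon
    exact ContinuousAt.comp (f := fun y => √τ * y + √(1 - τ) * z) (g := p) (x := x) hz'
      (by fun_prop)

theorem steinF_integrand_bound (p : ℝ → ℝ) (hb : ∀ x, |p x| ≤ 1) (τ x : ℝ) :
    ‖(√τ)⁻¹ * mehler p τ x‖ ≤ (√τ)⁻¹ := by
  rw [norm_mul, Real.norm_eq_abs, Real.norm_eq_abs, abs_of_nonneg (by positivity)]
  exact mul_le_of_le_one_right (by positivity) (mehler_bound p hb _ _)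

theorem steinF_meas_slice (p : ℝ → ℝ) (hp : Measurable p) (x : ℝ) :
    Measurable (fun τ : ℝ => (√τ)⁻¹ * mehler p τ x) := by
  have h1 : Measurable (fun τ : ℝ => mehler p τ x) :=
    (mehler_meas p hp).measurable.comp (measurable_id.prodMk measurable_const)
  fun_prop

theorem steinF_cont (p : ℝ → ℝ) (hp : Monotone p) (hb : ∀ x, |p x| ≤ 1) :
    Continuous (steinF p) := by
  refine intervalIntegral.continuous_of_dominated_interval (bound := fun τ => (√τ)⁻¹) ?_ ?_
    intInt_inv_sqrt ?_
  · exact fun x => (steinF_meas_slice p hp.measurable x).aestronglyMeasurable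
  · exact fun x => ae_of_all _ fun τ _ => steinF_integrand_bound p hb τ x
  · have : ∀ᵐ τ : ℝ, τ ≠ 1 := by simp [ae_iff]
    filter_upwards [this] with τ h1 hτ
    rw [Set.uIoc_of_le zero_le_one] at hτ
    exact continuous_const.mul (mehler_cont p hp hb τ (lt_of_le_of_ne hτ.2 h1))

theorem steinF_bound (p : ℝ → ℝ) (hb : ∀ x, |p x| ≤ 1) (x : ℝ) :
    |steinF p x| ≤ |∫ τ in (0 : ℝ)..1, (√τ)⁻¹| := by
  refine le_trans ?_ (le_abs_self _)
  exact intervalIntegral.norm_integral_le_of_norm_le zero_le_one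
    (ae_of_all _ fun τ _ => steinF_integrand_bound p hb τ x) intInt_inv_sqrt

theorem steinF_gauss (p : ℝ → ℝ) (hp : Monotone p) (hb : ∀ x, |p x| ≤ 1) (m a : ℝ) :
    ∫ y, steinF p (m + a * y) ∂gam =
      ∫ τ in (0 : ℝ)..1, (√τ)⁻¹ * ∫ w, p (√τ * m + √(τ * a ^ 2 + (1 - τ)) * w) ∂gam := by
  have hm := hp.measurable
  have step : ∀ τ ∈ Set.Ioc (0 : ℝ) 1,
      ∫ y, (√τ)⁻¹ * mehler p τ (m + a * y) ∂gam =
       (√τ)⁻¹ * ∫ w, p (√τ * m + √(τ * a ^ 2 + (1 - τ)) * w) ∂gam := by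
    intro τ hτ
    rw [integral_const_mul]
    congr 1
    have h1 : 0 ≤ 1 - τ := by linarith [hτ.2]
    have := gam_mix p hm hb (√τ * m) (√τ * a) (√(1 - τ)) (√(τ * a ^ 2 + (1 - τ))) (by
      rw [Real.sq_sqrt (by have := hτ.1; positivity), mul_pow, Real.sq_sqrt hτ.1.le,
        Real.sq_sqrt h1])
    rw [← this]
    congr 1; funext y
    unfold mehler
    congr 1; funext z
    congr 1; ring
  unfold steinF
  simp only [intervalIntegral.integral_of_le zero_le_one]
  rw [integral_integral_swap]
  · exact setIntegral_congr_fun measurableSet_Ioc step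
  · have hI : Integrable (fun τ : ℝ => (√τ)⁻¹) (volume.restrict (Set.Ioc 0 1)) := by
      have := intInt_inv_sqrt
      rwa [intervalIntegrable_iff, Set.uIoc_of_le zero_le_one] at this
    have hI2 := hI.comp_snd gam
    refine hI2.mono ?_ (ae_of_all _ fun q => ?_)
    · have h1 : Measurable (fun q : ℝ × ℝ => mehler p q.2 (m + a * q.1)) :=
        (mehler_meas p hm).measurable.comp (by fun_prop : Measurable fun q : ℝ × ℝ => (q.2, m + a * q.1))
      exact (by fun_prop : Measurable
        (fun q : ℝ × ℝ => (√q.2)⁻¹ * mehler p q.2 (m + a * q.1))).aestronglyMeasurable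
    · refine (steinF_integrand_bound p hb _ _).trans ?_
      exact le_abs_self _

theorem exp_abs_bound (z : ℝ) : |z| ≤ rexp z + rexp (-z) := by
  have h1 := Real.add_one_le_exp z
  have h2 := Real.add_one_le_exp (-z)
  have h3 := Real.exp_pos z
  have h4 := Real.exp_pos (-z)
  exact abs_le.2 ⟨by linarith, by linarith⟩

theorem lip_exp_integrable (h : ℝ → ℝ) (hlip : LipschitzWith 1 h) (s : ℝ) :
    Integrable (fun z => h z * rexp (s * z)) gam := by
  have hc := hlip.continuous
  have i1 : ∀ t : ℝ, Integrable (fun z => rexp (t * z)) gam := fun t =>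
    integrable_exp_mul_gaussianReal t
  have hB := (((i1 s).const_mul |h 0|).add (i1 (s + 1))).add (i1 (s - 1))
  refine hB.mono (by fun_prop) (ae_of_all _ fun z => ?_)
  refine le_trans ?_ (le_abs_self _)
  have hl := hlip.dist_le_mul z 0
  rw [Real.dist_eq, Real.dist_eq] at hl
  simp only [NNReal.coe_one, one_mul, sub_zero] at hl
  have h1 : |h z| ≤ |h 0| + (rexp z + rexp (-z)) := by
    have := abs_sub_abs_le_abs_sub (h z) (h 0)
    linarith [exp_abs_bound z]
  rw [norm_mul, Real.norm_eq_abs, Real.norm_eq_abs, abs_of_pos (Real.exp_pos _)]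
  refine (mul_le_mul_of_nonneg_right h1 (Real.exp_pos _).le).trans (le_of_eq ?_)
  simp only [Pi.add_apply]
  have e1 : rexp ((s + 1) * z) = rexp z * rexp (s * z) := by rw [← Real.exp_add]; ring_nf
  have e2 : rexp ((s - 1) * z) = rexp (-z) * rexp (s * z) := by rw [← Real.exp_add]; ring_nf
  rw [e1, e2]; ring

theorem lip_shift_integrable (h : ℝ → ℝ) (hlip : LipschitzWith 1 h) (u : ℝ) :
    Integrable (fun z => h (u + z)) gam := by
  have hl : LipschitzWith 1 (fun z => h (u + z)) := by
    have := hlip.comp (isometry_add_left u).lipschitz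
    simpa [Function.comp_def] using this
  simpa using lip_exp_integrable _ hl 0

theorem H_deriv (h p : ℝ → ℝ) (hlip : LipschitzWith 1 h) (hp : Measurable p)
    (hd : ∀ᵐ x, HasDerivAt h (p x) x) (u : ℝ) :
    HasDerivAt (fun u => ∫ z, h (u + z) ∂gam) (∫ z, p (u + z) ∂gam) u := by
  have hc := hlip.continuous
  refine (hasDerivAt_integral_of_dominated_loc_of_lip (F := fun u z => h (u + z))
    (F' := fun z => p (u + z)) (s := Set.univ) (bound := fun _ => 1) univ_mem ?_ ?_ ?_ ?_
    (integrable_const _) ?_).2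
  · exact Eventually.of_forall fun x => by fun_prop
  · exact lip_shift_integrable h hlip u
  · exact (by fun_prop : Measurable fun z => p (u + z)).aestronglyMeasurable
  · refine ae_of_all _ fun z => ?_
    have : LipschitzWith 1 (fun x => h (x + z)) := by
      have := hlip.comp (isometry_add_right z).lipschitz
      simpa [Function.comp_def] using this
    simpa using this.lipschitzOnWith (s := Set.univ)
  · have hv : ∀ᵐ z, HasDerivAt h (p (u + z)) (u + z) :=
      (measurePreserving_add_left volume u).quasiMeasurePreserving.ae hd
    have hg : ∀ᵐ z ∂gam, HasDerivAt h (p (u + z)) (u + z) :=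
      (gaussianReal_absolutelyContinuous 0 one_ne_zero).ae_le hv
    filter_upwards [hg] with z hz
    exact hz.comp_add_const u z

theorem H_ftc (h p : ℝ → ℝ) (hlip : LipschitzWith 1 h) (hp : Measurable p) (hb : ∀ x, |p x| ≤ 1)
    (hd : ∀ᵐ x, HasDerivAt h (p x) x) (s : ℝ) :
    s * ∫ τ in (0 : ℝ)..1, (√τ)⁻¹ * ∫ w, p (√τ * s + w) ∂gam =
      2 * ((∫ z, h (s + z) ∂gam) - ∫ z, h z ∂gam) := by
  set H := fun u => ∫ z, h (u + z) ∂gam with hH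
  have hD := H_deriv h p hlip hp hd
  have hHc : Continuous H := continuous_iff_continuousAt.2 fun u => (hD u).continuousAt
  have hmeas : Measurable (fun τ : ℝ => ∫ w, p (√τ * s + w) ∂gam) := by
    have : StronglyMeasurable (fun q : ℝ × ℝ => p (√q.1 * s + q.2)) :=
      (by fun_prop : Measurable (fun q : ℝ × ℝ => p (√q.1 * s + q.2))).stronglyMeasurable
    exact this.integral_prod_right'.measurable
  have hint : IntervalIntegrable (fun τ : ℝ => (√τ)⁻¹ * ∫ w, p (√τ * s + w) ∂gam) volume 0 1 := by
    refine intInt_inv_sqrt.mono_fun (by fun_prop) (ae_of_all _ fun τ => ?_)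
    simp only [norm_mul]
    exact mul_le_of_le_one_right (norm_nonneg _) (gam_bound _ fun _ => hb _)
  have := intervalIntegral.integral_eq_sub_of_hasDerivAt_of_le (a := 0) (b := 1)
    (f := fun τ => 2 * H (√τ * s))
    (f' := fun τ => s * ((√τ)⁻¹ * ∫ w, p (√τ * s + w) ∂gam)) zero_le_one
    (by fun_prop) ?_ (hint.const_mul s)
  · rw [intervalIntegral.integral_const_mul] at this
    rw [this]
    simp [hH]; ring
  · intro τ hτ
    have h1 : HasDerivAt (fun τ => √τ * s) (1 / (2 * √τ) * s) τ :=
      (Real.hasDerivAt_sqrt hτ.1.ne').mul_const s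
    have h2 := ((hD (√τ * s)).comp τ h1).const_mul 2
    refine h2.congr_deriv ?_
    have : √τ ≠ 0 := (Real.sqrt_pos.2 hτ.1).ne'
    field_simp

theorem gam_integral (g : ℝ → ℝ) : ∫ x, g x ∂gam = ∫ x, g x * gaussianPDFReal 0 1 x := by
  rw [integral_gaussianReal_eq_integral_smul one_ne_zero]
  simp only [smul_eq_mul, mul_comm]

theorem gam_integrable (g : ℝ → ℝ) (hg : Integrable g gam) :
    Integrable (fun x => g x * gaussianPDFReal 0 1 x) := by
  rw [gam, gaussianReal_of_var_ne_zero 0 one_ne_zero] at hg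
  rw [integrable_withDensity_iff_integrable_smul' (measurable_gaussianPDF 0 1)
    (ae_of_all _ fun x => gaussianPDF_lt_top)] at hg
  refine hg.congr (ae_of_all _ fun x => ?_)
  simp [toReal_gaussianPDF, mul_comm]

theorem pdf_cont : Continuous (gaussianPDFReal 0 1) := by
  unfold gaussianPDFReal
  fun_prop

section Primitive

theorem prim_deriv (k : ℝ → ℝ) (hk : Continuous k) (hi : Integrable k) (x : ℝ) :
    HasDerivAt (fun x => ∫ z in Set.Iic x, k z) (k x) x := by
  have e : (fun x => ∫ z in Set.Iic x, k z) =
      fun x => (∫ z in (0 : ℝ)..x, k z) + ∫ z in Set.Iic 0, k z := by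
    funext x
    rw [← intervalIntegral.integral_Iic_sub_Iic hi.integrableOn hi.integrableOn]
    ring
  rw [e]
  exact (intervalIntegral.integral_hasDerivAt_right (hk.intervalIntegrable _ _)
    (hk.stronglyMeasurableAtFilter _ _) hk.continuousAt).add_const _

theorem prim_bound_left (k : ℝ → ℝ) (hi : ∀ s : ℝ, Integrable (fun x => k x * rexp (s * x)))
    (a : ℝ) (ha : 0 ≤ a) (x : ℝ) :
    |∫ z in Set.Iic x, k z| ≤ (∫ z, |k z * rexp (-a * z)|) * rexp (a * x) := by
  have hi0 : Integrable k := by simpa using hi 0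
  calc |∫ z in Set.Iic x, k z| ≤ ∫ z in Set.Iic x, |k z| := abs_integral_le_integral_abs
    _ ≤ ∫ z in Set.Iic x, |k z * rexp (-a * z)| * rexp (a * x) := by
      refine setIntegral_mono_on hi0.abs.integrableOn
        ((hi (-a)).abs.mul_const _).integrableOn measurableSet_Iic fun z hz => ?_
      rw [abs_mul, abs_of_pos (Real.exp_pos _), mul_assoc, ← Real.exp_add]
      refine le_mul_of_one_le_right (abs_nonneg _) (Real.one_le_exp ?_)
      have hz' : z ≤ x := hz
      nlinarith
    _ ≤ ∫ z, |k z * rexp (-a * z)| * rexp (a * x) := by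
      refine setIntegral_le_integral ((hi (-a)).abs.mul_const _) (ae_of_all _ fun z => ?_)
      exact mul_nonneg (abs_nonneg _) (Real.exp_pos _).le
    _ = _ := integral_mul_const _ _

theorem prim_bound_right (k : ℝ → ℝ) (hi : ∀ s : ℝ, Integrable (fun x => k x * rexp (s * x)))
    (h0 : ∫ z, k z = 0) (a : ℝ) (ha : 0 ≤ a) (x : ℝ) :
    |∫ z in Set.Iic x, k z| ≤ (∫ z, |k z * rexp (a * z)|) * rexp (-a * x) := by
  have hi0 : Integrable k := by simpa using hi 0
  have e : ∫ z in Set.Iic x, k z = -∫ z in Set.Ioi x, k z := by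
    have := intervalIntegral.integral_Iic_add_Ioi (b := x) hi0.integrableOn hi0.integrableOn
    linarith
  rw [e, abs_neg]
  calc |∫ z in Set.Ioi x, k z| ≤ ∫ z in Set.Ioi x, |k z| := abs_integral_le_integral_abs
    _ ≤ ∫ z in Set.Ioi x, |k z * rexp (a * z)| * rexp (-a * x) := by
      refine setIntegral_mono_on hi0.abs.integrableOn
        ((hi a).abs.mul_const _).integrableOn measurableSet_Ioi fun z hz => ?_
      rw [abs_mul, abs_of_pos (Real.exp_pos _), mul_assoc, ← Real.exp_add]
      refine le_mul_of_one_le_right (abs_nonneg _) (Real.one_le_exp ?_)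
      have hz' : x < z := hz
      nlinarith
    _ ≤ ∫ z, |k z * rexp (a * z)| * rexp (-a * x) := by
      refine setIntegral_le_integral ((hi a).abs.mul_const _) (ae_of_all _ fun z => ?_)
      exact mul_nonneg (abs_nonneg _) (Real.exp_pos _).le
    _ = _ := integral_mul_const _ _

theorem prim_integrable (k : ℝ → ℝ) (hk : Continuous k)
    (hi : ∀ s : ℝ, Integrable (fun x => k x * rexp (s * x))) (h0 : ∫ z, k z = 0) (s : ℝ) :
    Integrable (fun x => (∫ z in Set.Iic x, k z) * rexp (s * x)) := by
  have hi0 : Integrable k := by simpa using hi 0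
  have hc : Continuous (fun x => ∫ z in Set.Iic x, k z) :=
    continuous_iff_continuousAt.2 fun x => (prim_deriv k hk hi0 x).continuousAt
  have hs1 := le_abs_self s
  have hs2 := neg_abs_le s
  have hs3 := abs_nonneg s
  rw [← integrableOn_univ, ← Set.Iic_union_Ioi (a := (0 : ℝ))]
  refine IntegrableOn.union ?_ ?_
  · refine ((integrableOn_exp_mul_Iic (a := |s| + 1 + s) (by linarith) 0).const_mul
      (∫ z, |k z * rexp (-(|s| + 1) * z)|)).mono (by fun_prop) (ae_of_all _ fun x => ?_)
    refine le_trans ?_ (le_abs_self _)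
    rw [norm_mul, Real.norm_eq_abs, Real.norm_eq_abs, abs_of_pos (Real.exp_pos _), add_mul,
      Real.exp_add, ← mul_assoc]
    exact mul_le_mul_of_nonneg_right (prim_bound_left k hi _ (by linarith) x) (Real.exp_pos _).le
  · refine ((integrableOn_exp_mul_Ioi (a := -(|s| + 1) + s) (by linarith) 0).const_mul
      (∫ z, |k z * rexp ((|s| + 1) * z)|)).mono (by fun_prop) (ae_of_all _ fun x => ?_)
    refine le_trans ?_ (le_abs_self _)
    rw [norm_mul, Real.norm_eq_abs, Real.norm_eq_abs, abs_of_pos (Real.exp_pos _), add_mul,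
      Real.exp_add, ← mul_assoc]
    exact mul_le_mul_of_nonneg_right (prim_bound_right k hi h0 _ (by linarith) x)
      (Real.exp_pos _).le

theorem prim_laplace (k : ℝ → ℝ) (hk : Continuous k)
    (hi : ∀ s : ℝ, Integrable (fun x => k x * rexp (s * x))) (h0 : ∫ z, k z = 0) (s : ℝ) :
    s * ∫ x, (∫ z in Set.Iic x, k z) * rexp (s * x) = -∫ x, k x * rexp (s * x) := by
  have hi0 : Integrable k := by simpa using hi 0
  have hG := prim_integrable k hk hi h0 s
  have := integral_mul_deriv_eq_deriv_mul_of_integrable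
    (u := fun x => ∫ z in Set.Iic x, k z) (u' := k) (v := fun x => rexp (s * x))
    (v' := fun x => s * rexp (s * x)) (fun x _ => prim_deriv k hk hi0 x)
    (fun x _ => by
      have h1 : HasDerivAt (fun x => s * x) s x := by
        simpa using (hasDerivAt_id x).const_mul s
      simpa [mul_comm] using h1.exp)
    ((hG.const_mul s).congr (ae_of_all _ fun x => by simp only [Pi.mul_apply]; ring))
    (hi s) hG
  rw [← this, ← integral_const_mul]
  congr 1; funext x; ring

end Primitive

theorem stein_core (h p : ℝ → ℝ) (hlip : LipschitzWith 1 h) (hp : Monotone p)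
    (hb : ∀ x, |p x| ≤ 1) (hd : ∀ᵐ x, HasDerivAt h (p x) x) (x : ℝ) :
    ∫ z in Set.Iic x, (h z - ∫ w, h w ∂gam) * gaussianPDFReal 0 1 z =
      -(1 / 2) * (gaussianPDFReal 0 1 x * steinF p x) := by
  set H0 := ∫ w, h w ∂gam with hH0
  set k := fun z => (h z - H0) * gaussianPDFReal 0 1 z with hkdef
  have hpc := pdf_cont
  have hhc := hlip.continuous
  have hFc := steinF_cont p hp hb
  have hk : Continuous k := by fun_prop
  have hE : ∀ t : ℝ, Integrable (fun z => rexp (t * z)) gam := fun t =>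
    integrable_exp_mul_gaussianReal t
  have hi : ∀ s : ℝ, Integrable (fun x => k x * rexp (s * x)) := by
    intro s
    have h1 := (lip_exp_integrable h hlip s).sub ((hE s).const_mul H0)
    refine (gam_integrable _ h1).congr (ae_of_all _ fun z => ?_)
    simp only [hkdef, Pi.sub_apply]; ring
  have hkE : ∀ s : ℝ, ∫ x, k x * rexp (s * x)
      = rexp (s ^ 2 / 2) * ((∫ z, h (s + z) ∂gam) - H0) := by
    intro s
    have e1 : ∫ x, k x * rexp (s * x) = ∫ x, (h x - H0) * rexp (s * x) ∂gam := by
      rw [gam_integral]; congr 1; funext z; simp only [hkdef]; ring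
    rw [e1, gam_tilt (fun x => h x - H0) s]
    congr 1
    have e2 : Integrable (fun x => h (x + s)) gam := by
      simpa [add_comm] using lip_shift_integrable h hlip s
    rw [integral_sub e2 (integrable_const _)]
    simp [add_comm]
  have h0 : ∫ z, k z = 0 := by
    have := hkE 0
    simpa [hH0] using this
  have hFi : ∀ s : ℝ, Integrable (fun x => steinF p x * rexp (s * x)) gam := by
    intro s
    exact (hE s).bdd_mul (c := |∫ τ in (0 : ℝ)..1, (√τ)⁻¹|) (by fun_prop)
      (ae_of_all _ fun x => steinF_bound p hb x)
  have hFi' : ∀ s : ℝ, Integrable (fun x => (gaussianPDFReal 0 1 x * steinF p x) * rexp (s * x)) := by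
    intro s
    refine (gam_integrable _ (hFi s)).congr (ae_of_all _ fun z => ?_)
    simp only; ring
  have hF : ∀ s : ℝ, s * ∫ x, (gaussianPDFReal 0 1 x * steinF p x) * rexp (s * x)
      = 2 * (rexp (s ^ 2 / 2) * ((∫ z, h (s + z) ∂gam) - H0)) := by
    intro s
    have e1 : ∫ x, (gaussianPDFReal 0 1 x * steinF p x) * rexp (s * x)
        = ∫ x, steinF p x * rexp (s * x) ∂gam := by
      rw [gam_integral]; congr 1; funext z; ring
    rw [e1, gam_tilt (steinF p) s]
    have e2 := steinF_gauss p hp hb s 1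
    have e3 := H_ftc h p hlip hp.measurable hb hd s
    have e4 : ∫ y, steinF p (y + s) ∂gam
        = ∫ τ in (0 : ℝ)..1, (√τ)⁻¹ * ∫ w, p (√τ * s + w) ∂gam := by
      simpa [add_comm] using e2
    rw [e4]
    linear_combination rexp (s ^ 2 / 2) * e3
  have hGc : Continuous (fun x => ∫ z in Set.Iic x, k z) :=
    continuous_iff_continuousAt.2 fun x => (prim_deriv k hk (by simpa using hi 0) x).continuousAt
  have hGi := prim_integrable k hk hi h0
  have hGL := prim_laplace k hk hi h0
  have main := uniq_laplace
    (fun x => (∫ z in Set.Iic x, k z) + (1 / 2) * (gaussianPDFReal 0 1 x * steinF p x))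
    (by fun_prop)
    (fun s => ((hGi s).add ((hFi' s).const_mul (1 / 2))).congr
      (ae_of_all _ fun x => by simp only [Pi.add_apply]; ring))
    (fun s hs => by
      have e : ∫ x, ((∫ z in Set.Iic x, k z) + (1 / 2) * (gaussianPDFReal 0 1 x * steinF p x))
          * rexp (s * x) = (∫ x, (∫ z in Set.Iic x, k z) * rexp (s * x)) +
            (1 / 2) * ∫ x, (gaussianPDFReal 0 1 x * steinF p x) * rexp (s * x) := by
        rw [← integral_const_mul, ← integral_add (hGi s) ((hFi' s).const_mul (1 / 2))]
        congr 1; funext x; ring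
      have h1 := hGL s
      rw [hkE s] at h1
      have h2 := hF s
      refine mul_left_cancel₀ hs ?_
      rw [e]
      linear_combination h1 + (1 / 2) * h2) x
  linarith

theorem lip_right_ae (h p : ℝ → ℝ) (hlip : LipschitzWith 1 h)
    (hr : ∀ x, HasDerivWithinAt h (p x) (Set.Ici x) x) : ∀ᵐ x, HasDerivAt h (p x) x := by
  filter_upwards [hlip.ae_differentiableAt_real] with x hx
  have h1 := hx.hasDerivAt
  have : deriv h x = p x := (uniqueDiffWithinAt_Ici x).eq_deriv _ h1.hasDerivWithinAt (hr x)
  rwa [← this]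

theorem lip_right_bound (h p : ℝ → ℝ) (hlip : LipschitzWith 1 h)
    (hr : ∀ x, HasDerivWithinAt h (p x) (Set.Ici x) x) (x : ℝ) : |p x| ≤ 1 := by
  have h1 := (hasDerivWithinAt_iff_tendsto_slope' (by simp)).1 (hr x).Ioi_of_Ici
  refine le_of_tendsto h1.abs (Eventually.of_forall fun y => ?_)
  rw [slope_def_field, abs_div]
  have := hlip.dist_le_mul y x
  rw [Real.dist_eq, Real.dist_eq] at this
  refine div_le_one_of_le₀ (by simpa using this) (abs_nonneg _)

theorem right_mono (h p : ℝ → ℝ) (hconv : ConvexOn ℝ Set.univ h)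
    (hr : ∀ x, HasDerivWithinAt h (p x) (Set.Ici x) x) : Monotone p := by
  have e : p = fun x => derivWithin h (Set.Ioi x) x := by
    funext x
    exact (((hr x).mono Set.Ioi_subset_Ici_self).derivWithin (uniqueDiffWithinAt_Ioi x)).symm
  have := hconv.monotoneOn_rightDeriv
  rw [interior_univ, monotoneOn_univ] at this
  rw [e]; exact this

theorem steinSol_eq (h : ℝ → ℝ) (hlip : LipschitzWith 1 h)
    (h' : ℝ → ℝ) (hm : Monotone h') (hderiv : ∀ x, HasDerivWithinAt h (h' x) (Set.Ici x) x)
    (μ σ : ℝ) (hσ : 0 < σ) (w : ℝ) :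
    steinSol μ σ h (μ + σ * w) = -(1 / 2) * steinF (fun v => h' (μ + σ * v)) w := by
  set g : ℝ → ℝ := fun v => h (μ + σ * v) / σ with hg
  have hglip : LipschitzWith 1 g := by
    refine LipschitzWith.of_dist_le_mul fun x y => ?_
    have := hlip.dist_le_mul (μ + σ * x) (μ + σ * y)
    rw [Real.dist_eq, Real.dist_eq] at *
    have e1 : μ + σ * x - (μ + σ * y) = σ * (x - y) := by ring
    rw [e1, abs_mul, abs_of_pos hσ] at this
    simp only [hg, ← sub_div, abs_div, abs_of_pos hσ]
    rw [div_le_iff₀ hσ]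
    linarith
  have hgr : ∀ x, HasDerivWithinAt g (h' (μ + σ * x)) (Set.Ici x) x := by
    intro x
    have h1 : HasDerivWithinAt (fun v => μ + σ * v) σ (Set.Ici x) x := by
      simpa using (((hasDerivAt_id x).const_mul σ).const_add μ).hasDerivWithinAt
    have h2 := (HasDerivWithinAt.comp x (hderiv (μ + σ * x)) h1 (fun y hy => by
      have hy' : x ≤ y := hy
      show μ + σ * x ≤ μ + σ * y
      gcongr)).div_const σ
    refine h2.congr_deriv ?_
    field_simp
  have hpm : Monotone (fun v => h' (μ + σ * v)) := fun x y hxy => hm (by gcongr)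
  have core := stein_core g _ hglip hpm (lip_right_bound g _ hglip hgr) (lip_right_ae g _ hglip hgr) w
  have hpdf : ∀ v, normalPdf μ σ (μ + σ * v) = σ⁻¹ * gaussianPDFReal 0 1 v := by
    intro v
    unfold normalPdf gaussianPDFReal
    have e1 : √(2 * π * σ ^ 2) = σ * √(2 * π) := by
      rw [Real.sqrt_mul (by positivity), Real.sqrt_sq hσ.le, mul_comm]
    rw [e1, mul_inv, mul_assoc]
    congr 2
    · simp
    · congr 1
      simp only [NNReal.coe_one]
      field_simp
      ring
  have hE : gaussExp (fun v => h (μ + σ * v)) = σ * ∫ v, g v ∂gam := by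
    unfold gaussExp
    rw [← integral_const_mul]
    congr 1; funext v; simp only [hg]; field_simp
  have hcv : ∫ z in Set.Iic (μ + σ * w), (h z - gaussExp (fun v => h (μ + σ * v))) * normalPdf μ σ z
      = σ * ∫ v in Set.Iic w, (g v - ∫ y, g y ∂gam) * gaussianPDFReal 0 1 v := by
    rw [hE, ← integral_indicator measurableSet_Iic, ← integral_indicator measurableSet_Iic,
      ← integral_add_left_eq_self _ μ]
    have := Measure.integral_comp_mul_left (fun z => (Set.Iic (μ + σ * w)).indicator
      (fun z => (h z - σ * ∫ v, g v ∂gam) * normalPdf μ σ z) (μ + z)) σ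
    rw [abs_of_pos (inv_pos.2 hσ), smul_eq_mul, inv_mul_eq_div, eq_div_iff hσ.ne'] at this
    rw [← this, mul_comm]
    congr 1
    congr 1; funext v
    by_cases hv : v ≤ w
    · rw [Set.indicator_of_mem (show μ + σ * v ∈ Set.Iic (μ + σ * w) by
          show μ + σ * v ≤ μ + σ * w
          gcongr), Set.indicator_of_mem (show v ∈ Set.Iic w from hv), hpdf]
      simp only [hg]
      field_simp
    · rw [Set.indicator_of_notMem (show μ + σ * v ∉ Set.Iic (μ + σ * w) by
          intro hc
          have hc' : μ + σ * v ≤ μ + σ * w := hc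
          exact hv (le_of_mul_le_mul_left (by linarith) hσ)),
        Set.indicator_of_notMem (show v ∉ Set.Iic w from hv)]
  unfold steinSol
  rw [hcv, core, hpdf]
  have := (gaussianPDFReal_pos 0 1 w one_ne_zero).ne'
  field_simp

/-- **Rewriting the algorithm's output** (Lemma D.1, first form): for convex `1`-Lipschitz `h`
with right derivative `h′`, for all `μ ∈ ℝ`, `σ > 0` and `c ∈ [0, σ²]`,
`E_Z[f_{μ,σ,h}(μ + √(σ²−c) Z)] = −(1/2) ∫_0^1 τ^{−1/2} E_Z[h′(μ + √(σ²−τc) Z)] dτ`. -/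
theorem stein_output_rewriting
    (h : ℝ → ℝ) (hconv : ConvexOn ℝ Set.univ h) (hlip : LipschitzWith 1 h)
    (h' : ℝ → ℝ) (hderiv : ∀ x, HasDerivWithinAt h (h' x) (Set.Ici x) x)
    (μ σ c : ℝ) (hσ : 0 < σ) (hc : c ∈ Set.Icc 0 (σ ^ 2)) :
    gaussExp (fun z => steinSol μ σ h (μ + Real.sqrt (σ ^ 2 - c) * z)) =
      -(1 / 2) * ∫ τ in (0 : ℝ)..1,
          (Real.sqrt τ)⁻¹ * gaussExp (fun z => h' (μ + Real.sqrt (σ ^ 2 - τ * c) * z)) := by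
  have hm := right_mono h h' hconv hderiv
  have hb := lip_right_bound h h' hlip hderiv
  have hpm : Monotone (fun v => h' (μ + σ * v)) := fun x y hxy => hm (by gcongr)
  have hs2 : 0 < σ ^ 2 := by positivity
  have hscale : ∀ t, σ * √(1 - t / σ ^ 2) = √(σ ^ 2 - t) := by
    intro t
    have e : σ ^ 2 - t = σ ^ 2 * (1 - t / σ ^ 2) := by field_simp
    rw [e, Real.sqrt_mul hs2.le, Real.sqrt_sq hσ.le]
  have e1 : gaussExp (fun z => steinSol μ σ h (μ + Real.sqrt (σ ^ 2 - c) * z)) =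
      -(1 / 2) * ∫ y, steinF (fun v => h' (μ + σ * v)) (0 + √(1 - c / σ ^ 2) * y) ∂gam := by
    unfold gaussExp
    rw [← integral_const_mul]
    congr 1; funext z
    beta_reduce
    rw [← hscale, mul_assoc, steinSol_eq h hlip h' hm hderiv μ σ hσ, zero_add]
  have hc1 : 0 ≤ 1 - c / σ ^ 2 := by
    rw [sub_nonneg, div_le_one hs2]; exact hc.2
  rw [e1, steinF_gauss _ hpm (fun v => hb _)]
  congr 1
  congr 1; funext τ
  congr 1
  unfold gaussExp
  congr 1; funext z
  congr 2
  rw [← hscale, Real.sq_sqrt hc1]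
  ring_nf
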